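/- arXiv:1801.04636 — 2 statements merged into one kernel-verified Lean document; each statement's English description precedes it below -/
import Mathlib

section
/- Let M be a metric space, φ : M → M a homeomorphism, f : M → ℝ continuous, and K ⊆ M a compact set with φ(K) = K. Then L_f(K) ⊆ M_f(K): for every x ∈ K there exists z ∈ K such that limsup_{n→∞} f(φ^n(x)) = sup_{n∈ℤ} f(φ^n(z)). -/
open Filter Topology

/-- The Lagrange value of `x` associated to `f` and `φ`:
`ℓ_{f,φ}(x) = limsup_{n → ∞} f(φⁿ(x))`. -/
noncomputable def lagrangeValue {M : Type*} (φ : M → M) (f : M → ℝ) (x : M) : ℝ :=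
  Filter.limsup (fun n : ℕ => f (φ^[n] x)) Filter.atTop

/-- The Markov value of `x` associated to `f` and an invertible map `φ`:
`m_{f,φ}(x) = sup_{n ∈ ℤ} f(φⁿ(x))`. -/
noncomputable def markovValue {M : Type*} (φ : M ≃ M) (f : M → ℝ) (x : M) : ℝ :=
  ⨆ n : ℤ, f ((φ ^ n) x)

/-- The Lagrange spectrum `L_f(Λ) = {ℓ_{f,φ}(x) : x ∈ Λ}` of a homeomorphism `φ`. -/
noncomputable def lagrangeSpectrum {M : Type*} [TopologicalSpace M] (φ : M ≃ₜ M)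
    (f : M → ℝ) (Λ : Set M) : Set ℝ :=
  (fun x => lagrangeValue (⇑φ) f x) '' Λ

/-- The Markov spectrum `M_f(Λ) = {m_{f,φ}(x) : x ∈ Λ}` of a homeomorphism `φ`. -/
noncomputable def markovSpectrum {M : Type*} [TopologicalSpace M] (φ : M ≃ₜ M)
    (f : M → ℝ) (Λ : Set M) : Set ℝ :=
  (fun x => markovValue φ.toEquiv f x) '' Λ

/-- `Λ_t = ⋂_{n ∈ ℤ} φⁿ(Λ ∩ f⁻¹((-∞, t]))`. -/
def sublevelInvariant {M : Type*} [TopologicalSpace M] (φ : M ≃ₜ M)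
    (f : M → ℝ) (Λ : Set M) (t : ℝ) : Set M :=
  ⋂ n : ℤ, (φ.toEquiv ^ n) '' (Λ ∩ f ⁻¹' Set.Iic t)

/-- The limsup of a bounded real sequence is a limit of the sequence along some ultrafilter
finer than `atTop`. -/
theorem exists_ultrafilter_tendsto_limsup {u : ℕ → ℝ} (hle : IsBoundedUnder (· ≤ ·) atTop u)
    (hge : IsBoundedUnder (· ≥ ·) atTop u) :
    ∃ U : Ultrafilter ℕ, (U : Filter ℕ) ≤ atTop ∧ Tendsto u U (𝓝 (limsup u atTop)) := by
  have hcluster : MapClusterPt (limsup u atTop) atTop u := by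
    rw [(nhds_basis_Ioo _).mapClusterPt_iff_frequently]
    rintro ⟨a, b⟩ ⟨ha, hb⟩
    exact (frequently_lt_of_lt_limsup hge.isCoboundedUnder_le ha).and_eventually
      (eventually_lt_of_limsup_lt hb hle)
  exact mapClusterPt_iff_ultrafilter.mp hcluster

/-- The integer powers of a homeomorphism are continuous. -/
theorem Homeomorph.continuous_toEquiv_zpow {X : Type*} [TopologicalSpace X] (φ : X ≃ₜ X) (m : ℤ) :
    Continuous (φ.toEquiv ^ m) := by
  induction m with
  | zero => exact continuous_id
  | succ n ih =>
    rw [zpow_add_one]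
    exact ih.comp φ.continuous
  | pred n ih =>
    rw [zpow_sub_one]
    exact ih.comp φ.symm.continuous

/-- `L_f(K) ⊆ M_f(K)`: for every `x ∈ K` there exists `z ∈ K` such that
`limsup_{n → ∞} f(φⁿ(x)) = sup_{n ∈ ℤ} f(φⁿ(z))`. -/
theorem lagrangeSpectrum_subset_markovSpectrum {M : Type*} [MetricSpace M]
    (φ : M ≃ₜ M) (f : M → ℝ) (hf : Continuous f)
    (K : Set M) (hK : IsCompact K) (hinv : (⇑φ) '' K = K) :
    ∀ x ∈ K, ∃ z ∈ K, lagrangeValue (⇑φ) f x = markovValue φ.toEquiv f z := by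
  intro x hx
  set u : ℕ → ℝ := fun n => f (φ^[n] x)
  have horbit : ∀ n : ℕ, φ^[n] x ∈ K := fun n =>
    (Set.mapsTo_iff_image_subset.mpr hinv.subset).iterate n hx
  have hrange : Set.range u ⊆ f '' K := by
    rintro _ ⟨n, rfl⟩
    exact ⟨_, horbit n, rfl⟩
  have hcompact := hK.image hf
  have hle : IsBoundedUnder (· ≤ ·) atTop u :=
    (hcompact.bddAbove.mono hrange).isBoundedUnder_of_range
  have hge : IsBoundedUnder (· ≥ ·) atTop u :=
    (hcompact.bddBelow.mono hrange).isBoundedUnder_of_range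
  obtain ⟨U, hU, hlim⟩ := exists_ultrafilter_tendsto_limsup hle hge
  obtain ⟨z, hz, hUz⟩ := hK.ultrafilter_le_nhds (U.map fun n => φ^[n] x)
    (le_principal_iff.mpr (Eventually.of_forall (f := (U : Filter ℕ)) horbit))
  have hUz : Tendsto (fun n => φ^[n] x) U (𝓝 z) := hUz
  have hfz : f z = limsup u atTop := tendsto_nhds_unique ((hf.tendsto z).comp hUz) hlim
  have hbound : ∀ m : ℤ, f ((φ.toEquiv ^ m) z) ≤ limsup u atTop := by
    intro m
    have htend : Tendsto (fun n : ℕ => f ((φ.toEquiv ^ m) (φ^[n] x))) U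
        (𝓝 (f ((φ.toEquiv ^ m) z))) :=
      ((hf.comp (φ.continuous_toEquiv_zpow m)).tendsto z).comp hUz
    refine le_of_forall_gt_imp_ge_of_dense fun b hb => le_of_tendsto htend ?_
    obtain ⟨N, hN⟩ := eventually_atTop.mp (eventually_lt_of_limsup_lt hb hle)
    filter_upwards [hU (eventually_ge_atTop (N + m.natAbs))] with n hn
    have hn : N + m.natAbs ≤ n := hn
    obtain ⟨k, hk⟩ := Int.eq_ofNat_of_zero_le (show 0 ≤ m + n by omega)
    have hshift : (φ.toEquiv ^ m) (φ^[n] x) = φ^[k] x := by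
      have hiter : ∀ j : ℕ, φ^[j] x = (φ.toEquiv ^ (j : ℤ)) x := fun j => by
        rw [zpow_natCast, ← Equiv.Perm.iterate_eq_pow]
        rfl
      rw [hiter, hiter, ← Equiv.Perm.mul_apply, ← zpow_add, hk]
    rw [hshift]
    exact (hN k (by omega)).le
  refine ⟨z, hz, le_antisymm ?_ (ciSup_le hbound)⟩
  exact hfz.symm.le.trans (le_ciSup (f := fun m : ℤ => f ((φ.toEquiv ^ m) z))
    ⟨_, Set.forall_mem_range.mpr hbound⟩ 0)
end

section
/- Let K and K' be C^s regular Cantor sets in ℝ with s > 1, let U ⊆ ℝ² be an open set with K × K' ⊆ U, and let f : U → ℝ be a C¹ function. If there exists (x₀, y₀) ∈ K × K' with ∂f/∂y (x₀, y₀) ≠ 0, then dimH(f(K × K')) > 0, where dimH denotes Hausdorff dimension. -/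
/-- A (candidate) regular Cantor set datum: a finite collection of pairwise disjoint
compact intervals `[a j, b j]`, together with an expanding map `ψ` defined on an open
neighbourhood `U` of their union, whose image of each interval is the convex hull of a
union of intervals of the collection. -/
structure CantorSystem (r : ℕ) where
  a : Fin r → ℝ
  b : Fin r → ℝ
  lt : ∀ j, a j < b j
  disj : ∀ i j, i ≠ j → Disjoint (Set.Icc (a i) (b i)) (Set.Icc (a j) (b j))
  U : Set ℝ
  openU : IsOpen U
  subU : ∀ j, Set.Icc (a j) (b j) ⊆ U
  ψ : ℝ → ℝ
  expand : ∀ x ∈ U, 1 < |deriv ψ x|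
  markov : ∀ j, ∃ T : Finset (Fin r), T.Nonempty ∧
    ψ '' Set.Icc (a j) (b j) = convexHull ℝ (⋃ t ∈ T, Set.Icc (a t) (b t))

namespace CantorSystem

variable {r : ℕ}

/-- The union of the intervals of the Markov partition. -/
def Iset (S : CantorSystem r) : Set ℝ := ⋃ j, Set.Icc (S.a j) (S.b j)

/-- The maximal invariant set `K = ⋂ₙ ψ⁻ⁿ(⋃ⱼ Iⱼ)`. -/
def K (S : CantorSystem r) : Set ℝ := ⋂ n : ℕ, (S.ψ)^[n] ⁻¹' S.Iset

/-- Regularity: the endpoints of each interval belong to `K`, and for each `j` and every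
sufficiently large `l`, `ψ^l(K ∩ Iⱼ) = K`. -/
def Regular (S : CantorSystem r) : Prop :=
  (∀ j, S.a j ∈ S.K ∧ S.b j ∈ S.K) ∧
  ∀ j, ∃ l₀ : ℕ, ∀ l ≥ l₀, (S.ψ)^[l] '' (S.K ∩ Set.Icc (S.a j) (S.b j)) = S.K

end CantorSystem

open MeasureTheory
open scoped NNReal ENNReal

/-- The binary expansion whose `n`-th digit records whether `g^[n] x ∈ A`. -/
theorem exists_binary_itinerary {X : Type*} (g : X → X) (A : Set X) :
    ∃ h : X → ℝ, (∀ x, 0 ≤ h x ∧ h x ≤ 1) ∧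
      ∀ x, h x = (A.indicator 1 x + h (g x)) / 2 := by
  have hdigit : ∀ y : X, 0 ≤ A.indicator (1 : X → ℝ) y ∧ A.indicator (1 : X → ℝ) y ≤ 1 := by
    intro y
    by_cases hy : y ∈ A <;> simp [hy]
  have hgeom : HasSum (fun n : ℕ => (1 : ℝ) / 2 / 2 ^ n) 1 := hasSum_geometric_two' 1
  have hnonneg : ∀ x n, 0 ≤ A.indicator (1 : X → ℝ) (g^[n] x) * ((1 : ℝ) / 2 / 2 ^ n) :=
    fun x n => mul_nonneg (hdigit _).1 (by positivity)
  have hle : ∀ x n, A.indicator (1 : X → ℝ) (g^[n] x) * ((1 : ℝ) / 2 / 2 ^ n) ≤ 1 / 2 / 2 ^ n :=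
    fun x n => mul_le_of_le_one_left (by positivity) (hdigit _).2
  have hsum : ∀ x, Summable fun n => A.indicator (1 : X → ℝ) (g^[n] x) * ((1 : ℝ) / 2 / 2 ^ n) :=
    fun x => Summable.of_nonneg_of_le (hnonneg x) (hle x) hgeom.summable
  refine ⟨fun x => ∑' n, A.indicator (1 : X → ℝ) (g^[n] x) * ((1 : ℝ) / 2 / 2 ^ n),
    fun x => ⟨tsum_nonneg (hnonneg x), ?_⟩, fun x => ?_⟩
  · exact ((hsum x).tsum_le_tsum (hle x) hgeom.summable).trans_eq hgeom.tsum_eq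
  · dsimp only
    rw [(hsum x).tsum_eq_zero_add, add_div, ← tsum_div_const]
    congr 1
    · simp [div_eq_mul_inv]
    · refine tsum_congr fun n => ?_
      rw [Function.iterate_succ_apply, pow_succ]
      ring

/-- Geometric decay of oscillation along geometric scales gives a Hölder estimate. -/
theorem exists_holderOnWith_of_geometric {X : Type*} [MetricSpace X] {s : Set X} {h : X → ℝ}
    {δ c : ℝ} (hδ : 0 < δ) (hc : 0 < c) (hc1 : c < 1)
    (h1 : ∀ x ∈ s, ∀ y ∈ s, dist (h x) (h y) ≤ 1)
    (hh : ∀ n : ℕ, ∀ x ∈ s, ∀ y ∈ s, dist x y ≤ δ * c ^ n → dist (h x) (h y) ≤ (1 / 2) ^ n) :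
    ∃ C r : ℝ≥0, 0 < r ∧ HolderOnWith C r h s := by
  have hlogc : Real.log c < 0 := Real.log_neg hc hc1
  have hlog2 : Real.log (1 / 2) < 0 := Real.log_neg (by norm_num) (by norm_num)
  obtain ⟨r, hr⟩ : ∃ r : ℝ, r = Real.log (1 / 2) / Real.log c := ⟨_, rfl⟩
  have hr0 : 0 < r := hr ▸ div_pos_of_neg_of_neg hlog2 hlogc
  have hcr : c ^ r = 1 / 2 := by
    rw [Real.rpow_def_of_pos hc, hr, mul_div_cancel₀ _ hlogc.ne, Real.exp_log (by norm_num)]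
  have key : ∀ x ∈ s, ∀ y ∈ s, dist (h x) (h y) ≤ 2 * (dist x y / δ) ^ r := by
    intro x hx y hy
    rcases eq_or_ne x y with rfl | hxy
    · simp only [dist_self]
      positivity
    have hd : 0 < dist x y / δ := div_pos (dist_pos.2 hxy) hδ
    rcases le_or_gt (dist x y / δ) 1 with hle | hgt
    · obtain ⟨n, hn, hn'⟩ := exists_nat_pow_near_of_lt_one hd hle hc hc1
      have hstep := hh n x hx y hy (by rwa [div_le_iff₀' hδ] at hn')
      have hpow : (c ^ (n + 1)) ^ r ≤ (dist x y / δ) ^ r :=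
        Real.rpow_le_rpow (by positivity) hn.le hr0.le
      rw [← Real.rpow_natCast, ← Real.rpow_mul hc.le, mul_comm, Real.rpow_mul hc.le, hcr,
        Real.rpow_natCast, pow_succ] at hpow
      linarith
    · have := Real.one_le_rpow hgt.le hr0.le
      linarith [h1 x hx y hy]
  refine ⟨Real.toNNReal (2 * δ⁻¹ ^ r), Real.toNNReal r, Real.toNNReal_pos.2 hr0,
    fun x hx y hy => ?_⟩
  have hC : 0 ≤ 2 * δ⁻¹ ^ r := by positivity
  rw [edist_dist, edist_dist, Real.coe_toNNReal _ hr0.le,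
    ENNReal.ofReal_rpow_of_nonneg dist_nonneg hr0.le]
  change _ ≤ ENNReal.ofReal _ * _
  rw [← ENNReal.ofReal_mul hC]
  refine ENNReal.ofReal_le_ofReal ((key x hx y hy).trans_eq ?_)
  rw [div_eq_mul_inv, Real.mul_rpow dist_nonneg (by positivity)]
  ring

/-- A compact invariant set on which a locally Lipschitz map has two full branches separated by a
relatively clopen set has positive Hausdorff dimension. -/
theorem dimH_pos_of_two_full_branches {X : Type*} [MetricSpace X] {s A : Set X} {g : X → X}
    {δ L : ℝ} (hs : IsCompact s) (hne : s.Nonempty) (hδ : 0 < δ) (hL : 1 < L)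
    (hmaps : Set.MapsTo g s s)
    (hA : ∀ x ∈ s, ∀ y ∈ s, dist x y ≤ δ → (x ∈ A ↔ y ∈ A))
    (hg : ∀ x ∈ s, ∀ y ∈ s, dist x y ≤ δ → dist (g x) (g y) ≤ L * dist x y)
    (hin : s ⊆ g '' (s ∩ A)) (hout : s ⊆ g '' (s \ A)) : 0 < dimH s := by
  obtain ⟨h, hbd, heq⟩ := exists_binary_itinerary g A
  have hL0 : 0 < L := by linarith
  have hone : ∀ x ∈ s, ∀ y ∈ s, dist (h x) (h y) ≤ 1 := by
    intro x _ y _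
    rw [Real.dist_eq, abs_le]
    constructor <;> linarith [(hbd x).1, (hbd x).2, (hbd y).1, (hbd y).2]
  have hgeom : ∀ n : ℕ, ∀ x ∈ s, ∀ y ∈ s, dist x y ≤ δ * L⁻¹ ^ n →
      dist (h x) (h y) ≤ (1 / 2) ^ n := by
    intro n
    induction n with
    | zero => simpa using fun x hx y hy _ => hone x hx y hy
    | succ n ih =>
      intro x hx y hy hxy
      have hle : dist x y ≤ δ :=
        hxy.trans (mul_le_of_le_one_right hδ.le
          (pow_le_one₀ (by positivity) (inv_le_one_of_one_le₀ hL.le)))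
      have hstep : dist (g x) (g y) ≤ δ * L⁻¹ ^ n := by
        refine (hg x hx y hy hle).trans ((mul_le_mul_of_nonneg_left hxy hL0.le).trans_eq ?_)
        rw [pow_succ]
        field_simp
      have hrec := ih _ (hmaps hx) _ (hmaps hy) hstep
      have hdigit : A.indicator (1 : X → ℝ) x = A.indicator 1 y := by
        have := hA x hx y hy hle
        by_cases hxA : x ∈ A
        · simp [hxA, this.1 hxA]
        · simp [hxA, mt this.2 hxA]
      rw [Real.dist_eq] at hrec ⊢
      rw [heq x, heq y, hdigit, pow_succ, show (A.indicator (1 : X → ℝ) y + h (g x)) / 2 -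
        (A.indicator 1 y + h (g y)) / 2 = (h (g x) - h (g y)) * (1 / 2) by ring, abs_mul,
        abs_of_pos (by norm_num : (0 : ℝ) < 1 / 2)]
      linarith
  obtain ⟨C, r, hr, hhol⟩ := exists_holderOnWith_of_geometric hδ (inv_pos.2 hL0)
    (inv_lt_one_of_one_lt₀ hL) hone hgeom
  have happrox : ∀ n : ℕ, ∀ t ∈ Set.Icc (0 : ℝ) 1, ∃ x ∈ s, |h x - t| ≤ (1 / 2) ^ n := by
    intro n
    induction n with
    | zero =>
      intro t ht
      obtain ⟨x, hx⟩ := hne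
      refine ⟨x, hx, ?_⟩
      rw [pow_zero, abs_le]
      constructor <;> linarith [(hbd x).1, (hbd x).2, ht.1, ht.2]
    | succ n ih =>
      intro t ht
      rcases le_or_gt t (1 / 2) with htl | htr
      · obtain ⟨z, hz, hzt⟩ := ih (2 * t) ⟨by linarith [ht.1], by linarith⟩
        obtain ⟨x, ⟨hx, hxA⟩, rfl⟩ := hout hz
        refine ⟨x, hx, ?_⟩
        rw [heq x, Set.indicator_of_notMem hxA, pow_succ]
        rw [abs_le] at hzt ⊢
        constructor <;> linarith [hzt.1, hzt.2]
      · obtain ⟨z, hz, hzt⟩ := ih (2 * t - 1) ⟨by linarith, by linarith [ht.2]⟩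
        obtain ⟨x, ⟨hx, hxA⟩, rfl⟩ := hin hz
        refine ⟨x, hx, ?_⟩
        rw [heq x, Set.indicator_of_mem hxA, pow_succ, Pi.one_apply]
        rw [abs_le] at hzt ⊢
        constructor <;> linarith [hzt.1, hzt.2]
  have himage : Set.Icc (0 : ℝ) 1 ⊆ h '' s := by
    have hclosed : IsClosed (h '' s) := (hs.image_of_continuousOn (hhol.continuousOn hr)).isClosed
    intro t ht
    rw [← hclosed.closure_eq, Metric.mem_closure_iff]
    intro ε hε
    obtain ⟨n, hn⟩ := exists_pow_lt_of_lt_one hε (by norm_num : (1 / 2 : ℝ) < 1)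
    obtain ⟨x, hx, hxt⟩ := happrox n t ht
    exact ⟨h x, ⟨x, hx, rfl⟩, by rw [dist_comm, Real.dist_eq]; linarith⟩
  have hdim : (1 : ℝ≥0∞) ≤ dimH s / r := by
    have hIcc : dimH (Set.Icc (0 : ℝ) 1) = 1 := by
      rw [Real.dimH_of_nonempty_interior (by simp)]
      simp
    rw [← hIcc]
    exact (dimH_mono himage).trans (hhol.dimH_image_le hr)
  refine pos_iff_ne_zero.2 fun h0 => ?_
  simp [h0] at hdim

/-- A function that expands distances by a definite factor on `s` does not decrease `dimH s`. -/
theorem le_dimH_image_of_expanding {X Y : Type*} [MetricSpace X] [MetricSpace Y] {f : X → Y}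
    {s : Set X} {c : ℝ} (hc : 0 < c) (h : ∀ x ∈ s, ∀ y ∈ s, c * dist x y ≤ dist (f x) (f y)) :
    dimH s ≤ dimH (f '' s) := by
  have hanti : AntilipschitzWith (Real.toNNReal c⁻¹) (s.domRestrict f) :=
    AntilipschitzWith.of_le_mul_dist fun x y => by
      rw [Real.coe_toNNReal _ (inv_pos.2 hc).le, inv_mul_eq_div, le_div_iff₀' hc]
      exact h x x.2 y y.2
  have hdim := hanti.le_dimH_image Set.univ
  rwa [Set.image_univ, Set.range_domRestrict, ← isometry_subtype_coe.dimH_image, Set.image_univ,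
    Subtype.range_coe] at hdim

theorem HasStrictDerivAt.exists_expanding {f : ℝ → ℝ} {f' x : ℝ} (h : HasStrictDerivAt f f' x)
    (hf' : f' ≠ 0) :
    ∃ ε > 0, ∀ y, dist y x < ε → ∀ z, dist z x < ε → |f'| / 2 * dist y z ≤ dist (f y) (f z) := by
  have hpos : 0 < |f'| := abs_pos.2 hf'
  have hev := h.isLittleO.bound (half_pos hpos)
  rw [Metric.eventually_nhds_iff] at hev
  obtain ⟨ε, hε, hev⟩ := hev
  refine ⟨ε, hε, fun y hy z hz => ?_⟩
  have hyz := hev (y := (y, z)) (by rw [Prod.dist_eq]; exact max_lt hy hz)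
  simp only [ContinuousLinearMap.toSpanSingleton_apply, smul_eq_mul, Real.norm_eq_abs] at hyz
  rw [Real.dist_eq, Real.dist_eq]
  have htri := abs_sub_abs_le_abs_sub ((y - z) * f') (f y - f z)
  rw [abs_sub_comm ((y - z) * f'), abs_mul] at htri
  linarith

namespace CantorSystem

variable {r : ℕ} (S : CantorSystem r)

theorem K_subset_Iset : S.K ⊆ S.Iset := fun _ hx => Set.mem_iInter.1 hx 0

theorem mapsTo_K : Set.MapsTo S.ψ S.K S.K := fun x hx =>
  Set.mem_iInter.2 fun n => by
    simpa only [Set.mem_preimage, Function.iterate_succ_apply] using Set.mem_iInter.1 hx (n + 1)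

variable {S}

theorem subset_K_of_mapsTo {A : Set ℝ} (hA : A ⊆ S.Iset) (hmaps : Set.MapsTo S.ψ A A) :
    A ⊆ S.K := fun _ hx => Set.mem_iInter.2 fun n => hA (hmaps.iterate n hx)

theorem mem_K_of_apply_mem {x : ℝ} (hx : x ∈ S.Iset) (hψ : S.ψ x ∈ S.K) : x ∈ S.K := by
  have hsub : insert x S.K ⊆ S.K := by
    refine subset_K_of_mapsTo (Set.insert_subset hx S.K_subset_Iset) ?_
    rintro y (rfl | hy)
    · exact Or.inr hψ
    · exact Or.inr (S.mapsTo_K hy)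
  exact hsub (Set.mem_insert x _)

theorem exists_mem_Icc {x : ℝ} (hx : x ∈ S.K) : ∃ j, x ∈ Set.Icc (S.a j) (S.b j) :=
  Set.mem_iUnion.1 (S.K_subset_Iset hx)

variable (S)

theorem Iset_subset_U : S.Iset ⊆ S.U := Set.iUnion_subset S.subU

theorem isCompact_Iset : IsCompact S.Iset := isCompact_iUnion fun _ => isCompact_Icc

theorem isCompact_K (hψ : ContinuousOn S.ψ S.U) : IsCompact S.K := by
  have hcl : closure S.K ⊆ S.Iset := closure_minimal S.K_subset_Iset S.isCompact_Iset.isClosed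
  have hmaps : Set.MapsTo S.ψ (closure S.K) (closure S.K) :=
    S.mapsTo_K.closure_of_continuousOn (hψ.mono (hcl.trans S.Iset_subset_U))
  exact S.isCompact_Iset.of_isClosed_subset
    (closure_subset_iff_isClosed.1 (subset_K_of_mapsTo hcl hmaps)) S.K_subset_Iset

/-- Distinct intervals of the partition are uniformly separated. -/
theorem exists_separation : ∃ δ > 0, ∀ i j, ∀ x ∈ Set.Icc (S.a i) (S.b i),
    ∀ y ∈ Set.Icc (S.a j) (S.b j), dist x y ≤ δ → i = j := by
  have hev : ∀ i j, ∀ᶠ δ in nhdsWithin (0 : ℝ) (Set.Ioi 0), ∀ x ∈ Set.Icc (S.a i) (S.b i),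
      ∀ y ∈ Set.Icc (S.a j) (S.b j), dist x y ≤ δ → i = j := by
    intro i j
    rcases eq_or_ne i j with hij | hij
    · exact Filter.Eventually.of_forall fun _ _ _ _ _ _ => hij
    have hdisj : S.b i < S.a j ∨ S.b j < S.a i := by
      by_contra! hcon
      have hmem : max (S.a i) (S.a j) ∈ Set.Icc (S.a i) (S.b i) :=
        ⟨le_max_left _ _, max_le (S.lt i).le hcon.1⟩
      exact Set.disjoint_left.1 (S.disj i j hij) hmem
        ⟨le_max_right _ _, max_le hcon.2 (S.lt j).le⟩
    rcases hdisj with hlt | hlt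
    · filter_upwards [Ioo_mem_nhdsGT (sub_pos.2 hlt)] with δ hδ x hx y hy hxy
      rw [Real.dist_eq, abs_le] at hxy
      linarith [hδ.2, hx.2, hy.1, hxy.1]
    · filter_upwards [Ioo_mem_nhdsGT (sub_pos.2 hlt)] with δ hδ x hx y hy hxy
      rw [Real.dist_eq, abs_le] at hxy
      linarith [hδ.2, hx.1, hy.2, hxy.2]
  have hall := Filter.eventually_all.2 fun i => Filter.eventually_all.2 (hev i)
  obtain ⟨δ, hδ, hpos⟩ := (hall.and self_mem_nhdsWithin).exists
  exact ⟨δ, hpos, hδ⟩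

variable {S}

theorem exists_dist_eq_deriv_mul (hψ : DifferentiableOn ℝ S.ψ S.U) {j : Fin r} {x y : ℝ}
    (hx : x ∈ Set.Icc (S.a j) (S.b j)) (hy : y ∈ Set.Icc (S.a j) (S.b j)) :
    ∃ ξ ∈ Set.Icc (S.a j) (S.b j), dist (S.ψ x) (S.ψ y) = |deriv S.ψ ξ| * dist x y := by
  wlog hxy : x < y generalizing x y
  · rcases (not_lt.1 hxy).eq_or_lt with rfl | hlt
    · exact ⟨y, hy, by simp⟩
    · simpa only [dist_comm] using this hy hx hlt
  have hsub : Set.Icc x y ⊆ S.U := (Set.Icc_subset_Icc hx.1 hy.2).trans (S.subU j)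
  obtain ⟨ξ, hξ, hslope⟩ := exists_deriv_eq_slope S.ψ hxy (hψ.continuousOn.mono hsub)
    (hψ.mono (Set.Ioo_subset_Icc_self.trans hsub))
  refine ⟨ξ, ⟨hx.1.trans hξ.1.le, hξ.2.le.trans hy.2⟩, ?_⟩
  rw [hslope, dist_comm, dist_comm x, Real.dist_eq, Real.dist_eq, ← abs_mul,
    div_mul_cancel₀ _ (sub_pos.2 hxy).ne']

/-- On a single interval, `ψ` is Lipschitz and uniformly expanding. -/
theorem exists_expansion_bounds [Nonempty (Fin r)] (hψ : ContDiffOn ℝ 1 S.ψ S.U) :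
    ∃ m L : ℝ, 1 < m ∧ ∀ j, ∀ x ∈ Set.Icc (S.a j) (S.b j), ∀ y ∈ Set.Icc (S.a j) (S.b j),
      m * dist x y ≤ dist (S.ψ x) (S.ψ y) ∧ dist (S.ψ x) (S.ψ y) ≤ L * dist x y := by
  have hcont : ContinuousOn (fun x => |deriv S.ψ x|) S.Iset :=
    ((hψ.continuousOn_deriv_of_isOpen S.openU le_rfl).mono S.Iset_subset_U).abs
  have hne : S.Iset.Nonempty :=
    ⟨_, Set.mem_iUnion.2 ⟨Classical.arbitrary _, Set.left_mem_Icc.2 (S.lt _).le⟩⟩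
  obtain ⟨p, hp, hmin⟩ := S.isCompact_Iset.exists_isMinOn hne hcont
  obtain ⟨q, -, hmax⟩ := S.isCompact_Iset.exists_isMaxOn hne hcont
  refine ⟨|deriv S.ψ p|, |deriv S.ψ q|, S.expand p (S.Iset_subset_U hp), fun j x hx y hy => ?_⟩
  obtain ⟨ξ, hξ, heq⟩ := exists_dist_eq_deriv_mul (hψ.differentiableOn one_ne_zero) hx hy
  have hξI : ξ ∈ S.Iset := Set.mem_iUnion.2 ⟨j, hξ⟩
  rw [heq]
  exact ⟨mul_le_mul_of_nonneg_right (hmin hξI) dist_nonneg,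
    mul_le_mul_of_nonneg_right (hmax hξI) dist_nonneg⟩

theorem Regular.exists_ne (hreg : S.Regular) (hψ : DifferentiableOn ℝ S.ψ S.U) (j : Fin r) :
    ∃ i, i ≠ j := by
  by_contra! hall
  have hmem : ∀ x ∈ S.K, x ∈ Set.Icc (S.a j) (S.b j) := fun x hx => by
    obtain ⟨i, hi⟩ := exists_mem_Icc hx
    rwa [hall i] at hi
  obtain ⟨ha, hb⟩ := hreg.1 j
  obtain ⟨ξ, hξ, heq⟩ := exists_dist_eq_deriv_mul hψ (hmem _ hb) (hmem _ ha)
  have hpos : 0 < dist (S.b j) (S.a j) := dist_pos.2 (S.lt j).ne'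
  have hexp := S.expand ξ (S.subU j hξ)
  have hle := Real.dist_le_of_mem_Icc (hmem _ (S.mapsTo_K hb)) (hmem _ (S.mapsTo_K ha))
  rw [Real.dist_eq (S.b j), abs_of_pos (sub_pos.2 (S.lt j))] at heq hpos
  nlinarith

/-- An interval of the partition meeting `ψ(Iⱼ)` is contained in it. -/
theorem Icc_subset_image {i j : Fin r} {y : ℝ} (hy : y ∈ Set.Icc (S.a i) (S.b i))
    (hyψ : S.ψ y ∈ Set.Icc (S.a j) (S.b j)) :
    Set.Icc (S.a j) (S.b j) ⊆ S.ψ '' Set.Icc (S.a i) (S.b i) := by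
  obtain ⟨T, -, hT⟩ := S.markov i
  have hyH : S.ψ y ∈ convexHull ℝ (⋃ t ∈ T, Set.Icc (S.a t) (S.b t)) := hT ▸ ⟨y, hy, rfl⟩
  have hord := (convex_convexHull ℝ (⋃ t ∈ T, Set.Icc (S.a t) (S.b t))).ordConnected
  have hsub := subset_convexHull ℝ (⋃ t ∈ T, Set.Icc (S.a t) (S.b t))
  rw [hT]
  by_cases hj : j ∈ T
  · exact (Set.subset_biUnion_of_mem (u := fun t => Set.Icc (S.a t) (S.b t)) hj).trans hsub
  have hdisj : ∀ p ∈ ⋃ t ∈ T, Set.Icc (S.a t) (S.b t), p ∉ Set.Icc (S.a j) (S.b j) := by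
    intro p hp hpj
    obtain ⟨t, ht, hpt⟩ := Set.mem_iUnion₂.1 hp
    exact Set.disjoint_left.1 (S.disj t j (ne_of_mem_of_not_mem ht hj)) hpt hpj
  intro z hz
  by_contra hzH
  rcases lt_trichotomy z (S.ψ y) with hlt | heq | hgt
  · have hmin : convexHull ℝ (⋃ t ∈ T, Set.Icc (S.a t) (S.b t)) ⊆ Set.Ioi (S.b j) := by
      refine convexHull_min (fun p hp => ?_) (convex_Ioi _)
      by_contra hpb
      rcases le_or_gt p z with hpz | hzp
      · exact hzH (hord.out (hsub hp) hyH ⟨hpz, hlt.le⟩)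
      · exact hdisj p hp ⟨hz.1.trans hzp.le, not_lt.1 hpb⟩
    exact (hmin hyH).not_ge hyψ.2
  · exact hzH (heq ▸ hyH)
  · have hmin : convexHull ℝ (⋃ t ∈ T, Set.Icc (S.a t) (S.b t)) ⊆ Set.Iio (S.a j) := by
      refine convexHull_min (fun p hp => ?_) (convex_Iio _)
      by_contra hpa
      rcases le_or_gt z p with hzp | hpz
      · exact hzH (hord.out hyH (hsub hp) ⟨hgt.le, hzp⟩)
      · exact hdisj p hp ⟨not_lt.1 hpa, hpz.le.trans hz.2⟩
    exact (hmin hyH).not_ge hyψ.1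

/-- Points of `K` in the interval containing `ψ^[n] y` pull back along the orbit of `y`. -/
theorem exists_pullback {m : ℝ} (hm : 1 < m)
    (hexp : ∀ j, ∀ x ∈ Set.Icc (S.a j) (S.b j), ∀ y ∈ Set.Icc (S.a j) (S.b j),
      m * dist x y ≤ dist (S.ψ x) (S.ψ y)) (n : ℕ) :
    ∀ i, ∀ y ∈ S.K ∩ Set.Icc (S.a i) (S.b i), ∃ j, ∀ z ∈ S.K ∩ Set.Icc (S.a j) (S.b j),
      dist z (S.ψ^[n] y) ≤ S.b j - S.a j ∧
      ∃ w ∈ S.K ∩ Set.Icc (S.a i) (S.b i), S.ψ^[n] w = z ∧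
        m ^ n * dist w y ≤ dist z (S.ψ^[n] y) := by
  induction n with
  | zero =>
    intro i y hy
    exact ⟨i, fun z hz => ⟨Real.dist_le_of_mem_Icc hz.2 hy.2, z, hz, rfl, by simp⟩⟩
  | succ n ih =>
    intro i y hy
    obtain ⟨i', hi'⟩ := exists_mem_Icc (S.mapsTo_K hy.1)
    obtain ⟨j, hj⟩ := ih i' (S.ψ y) ⟨S.mapsTo_K hy.1, hi'⟩
    refine ⟨j, fun z hz => ?_⟩
    obtain ⟨hdiam, w', hw', hiter, hdist⟩ := hj z hz
    obtain ⟨w, hw, rfl⟩ := Icc_subset_image hy.2 hi' hw'.2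
    refine ⟨hdiam, w, ⟨mem_K_of_apply_mem (Set.mem_iUnion.2 ⟨i, hw⟩) hw'.1, hw⟩, hiter, ?_⟩
    refine le_trans ?_ hdist
    rw [pow_succ, mul_assoc]
    exact mul_le_mul_of_nonneg_left (hexp i w hw y hy.2) (by positivity)

/-- Iterates of `ψ` are uniformly locally Lipschitz on `K`. -/
theorem exists_iterate_lipschitz [Nonempty (Fin r)] (hψ : ContDiffOn ℝ 1 S.ψ S.U) (n : ℕ) :
    ∃ δ > 0, ∃ L > 1, ∀ x ∈ S.K, ∀ y ∈ S.K, dist x y ≤ δ →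
      dist (S.ψ^[n] x) (S.ψ^[n] y) ≤ L * dist x y := by
  obtain ⟨δ₀, hδ₀, hsep⟩ := S.exists_separation
  obtain ⟨m, L₀, -, hbounds⟩ := exists_expansion_bounds hψ
  induction n with
  | zero =>
    exact ⟨1, one_pos, 2, one_lt_two, fun x _ y _ _ => by
      simpa using le_mul_of_one_le_left dist_nonneg one_le_two⟩
  | succ n ih =>
    obtain ⟨δ, hδ, L, hL, hlip⟩ := ih
    have hL₁ : 1 ≤ max 1 L₀ := le_max_left _ _
    refine ⟨min δ₀ (δ / max 1 L₀), by positivity, L * max 1 L₀,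
      one_lt_mul_of_lt_of_le hL hL₁, fun x hx y hy hxy => ?_⟩
    obtain ⟨i, hi⟩ := exists_mem_Icc hx
    obtain ⟨j, hj⟩ := exists_mem_Icc hy
    obtain rfl := hsep i j x hi y hj (hxy.trans (min_le_left _ _))
    have hstep : dist (S.ψ x) (S.ψ y) ≤ max 1 L₀ * dist x y :=
      (hbounds i x hi y hj).2.trans (mul_le_mul_of_nonneg_right (le_max_right _ _) dist_nonneg)
    have hclose : dist (S.ψ x) (S.ψ y) ≤ δ := by
      refine hstep.trans ?_
      have := hxy.trans (min_le_right _ _)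
      rwa [le_div_iff₀' (by positivity)] at this
    rw [Function.iterate_succ_apply, Function.iterate_succ_apply, mul_assoc]
    exact (hlip _ (S.mapsTo_K hx) _ (S.mapsTo_K hy) hclose).trans
      (mul_le_mul_of_nonneg_left hstep (by linarith))

theorem dimH_iterate_image_le [Nonempty (Fin r)] (hψ : ContDiffOn ℝ 1 S.ψ S.U) (n : ℕ)
    {A : Set ℝ} (hA : A ⊆ S.K) : dimH (S.ψ^[n] '' A) ≤ dimH A := by
  obtain ⟨δ, hδ, L, hL, hlip⟩ := exists_iterate_lipschitz hψ n
  refine dimH_image_le_of_locally_lipschitzOn fun x _ => ⟨Real.toNNReal L,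
    Metric.closedBall x (δ / 2) ∩ A,
    Filter.inter_mem (mem_nhdsWithin_of_mem_nhds (Metric.closedBall_mem_nhds x (half_pos hδ)))
      self_mem_nhdsWithin, LipschitzOnWith.of_dist_le_mul fun y hy z hz => ?_⟩
  rw [Real.coe_toNNReal _ (by linarith)]
  refine hlip y (hA hy.2) z (hA hz.2) ((dist_triangle_right y z x).trans ?_)
  linarith [Metric.mem_closedBall.1 hy.1, Metric.mem_closedBall.1 hz.1]

theorem Regular.exists_iterate_image_eq (hreg : S.Regular) :
    ∃ l : ℕ, ∀ j, S.ψ^[l] '' (S.K ∩ Set.Icc (S.a j) (S.b j)) = S.K := by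
  choose l₀ hl₀ using hreg.2
  exact ⟨Finset.univ.sup l₀, fun j => hl₀ j _ (Finset.le_sup (Finset.mem_univ j))⟩

theorem Regular.dimH_K_pos [Nonempty (Fin r)] (hreg : S.Regular)
    (hψ : ContDiffOn ℝ 1 S.ψ S.U) : 0 < dimH S.K := by
  obtain ⟨l, hl⟩ := hreg.exists_iterate_image_eq
  obtain ⟨j⟩ : Nonempty (Fin r) := inferInstance
  obtain ⟨i, hij⟩ := hreg.exists_ne (hψ.differentiableOn one_ne_zero) j
  obtain ⟨δ₀, hδ₀, hsep⟩ := S.exists_separation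
  obtain ⟨δ, hδ, L, hL, hlip⟩ := exists_iterate_lipschitz hψ l
  have hmem : ∀ x ∈ S.K, ∀ y ∈ S.K, dist x y ≤ δ₀ → x ∈ Set.Icc (S.a j) (S.b j) →
      y ∈ Set.Icc (S.a j) (S.b j) := by
    intro x _ y hy hxy hxj
    obtain ⟨k, hk⟩ := exists_mem_Icc hy
    rwa [← hsep j k x hxj y hk hxy] at hk
  refine dimH_pos_of_two_full_branches (A := Set.Icc (S.a j) (S.b j)) (g := S.ψ^[l])
    (S.isCompact_K hψ.continuousOn) ⟨_, (hreg.1 j).1⟩ (lt_min hδ₀ hδ) hL (S.mapsTo_K.iterate l)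
    (fun x hx y hy hxy => ?_) (fun x hx y hy hxy => hlip x hx y hy (hxy.trans (min_le_right _ _)))
    (hl j).ge ((hl i).ge.trans (Set.image_mono fun x hx => ⟨hx.1, fun hxj => ?_⟩))
  · have hle := hxy.trans (min_le_left _ _)
    exact ⟨hmem x hx y hy hle, hmem y hy x hx (by rwa [dist_comm])⟩
  · exact Set.disjoint_left.1 (S.disj i j hij) hx.2 hxj

/-- A regular Cantor set has positive Hausdorff dimension near each of its points. -/
theorem Regular.dimH_K_inter_ball_pos (hreg : S.Regular) (hψ : ContDiffOn ℝ 1 S.ψ S.U) {y ε : ℝ}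
    (hy : y ∈ S.K) (hε : 0 < ε) : 0 < dimH (S.K ∩ Metric.ball y ε) := by
  obtain ⟨i, hi⟩ := exists_mem_Icc hy
  have : Nonempty (Fin r) := ⟨i⟩
  obtain ⟨m, _, hm, hbounds⟩ := exists_expansion_bounds hψ
  obtain ⟨l, hl⟩ := hreg.exists_iterate_image_eq
  obtain ⟨n, hn⟩ := pow_unbounded_of_one_lt ((∑ j, (S.b j - S.a j)) / ε) hm
  obtain ⟨j, hj⟩ := exists_pullback hm (fun j x hx y hy => (hbounds j x hx y hy).1) n i y ⟨hy, hi⟩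
  have hsub : S.K ∩ Set.Icc (S.a j) (S.b j) ⊆ S.ψ^[n] '' (S.K ∩ Metric.ball y ε) := by
    intro z hz
    obtain ⟨hdiam, w, hw, hiter, hdist⟩ := hj z hz
    refine ⟨w, ⟨hw.1, ?_⟩, hiter⟩
    have hle : S.b j - S.a j ≤ ∑ j, (S.b j - S.a j) :=
      Finset.single_le_sum (f := fun j => S.b j - S.a j)
        (fun k _ => (sub_pos.2 (S.lt k)).le) (Finset.mem_univ j)
    rw [div_lt_iff₀ hε] at hn
    rw [Metric.mem_ball]
    exact lt_of_mul_lt_mul_left (((hdist.trans hdiam).trans hle).trans_lt hn) (by positivity)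
  calc 0 < dimH S.K := hreg.dimH_K_pos hψ
    _ = dimH (S.ψ^[l] '' (S.K ∩ Set.Icc (S.a j) (S.b j))) := by rw [hl j]
    _ ≤ dimH (S.K ∩ Set.Icc (S.a j) (S.b j)) := dimH_iterate_image_le hψ l Set.inter_subset_left
    _ ≤ dimH (S.ψ^[n] '' (S.K ∩ Metric.ball y ε)) := dimH_mono hsub
    _ ≤ dimH (S.K ∩ Metric.ball y ε) := dimH_iterate_image_le hψ n Set.inter_subset_left

end CantorSystem

/-- If `K, K'` are `C^s` regular Cantor sets (`s > 1`), `f` is a `C¹`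
function on an open set `U ⊇ K × K'` and some partial derivative `∂f/∂y` is nonzero at a
point of `K × K'`, then `f(K × K')` has positive Hausdorff dimension. -/
theorem dimH_image_prod_pos
    {r r' : ℕ} (S : CantorSystem r) (S' : CantorSystem r')
    (s : ℕ∞) (hs : 1 < s)
    (hsm : ContDiffOn ℝ s S.ψ S.U) (hsm' : ContDiffOn ℝ s S'.ψ S'.U)
    (hreg : S.Regular) (hreg' : S'.Regular)
    (U : Set (ℝ × ℝ)) (hU : IsOpen U) (hKU : S.K ×ˢ S'.K ⊆ U)
    (f : ℝ × ℝ → ℝ) (hf : ContDiffOn ℝ 1 f U)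
    (x₀ y₀ : ℝ) (hx₀ : x₀ ∈ S.K) (hy₀ : y₀ ∈ S'.K)
    (hdy : deriv (fun y => f (x₀, y)) y₀ ≠ 0) :
    0 < dimH (f '' (S.K ×ˢ S'.K)) := by
  have hψ : ContDiffOn ℝ 1 S'.ψ S'.U := hsm'.of_le (by exact_mod_cast hs.le)
  have hslice : ContDiffAt ℝ 1 (fun y => f (x₀, y)) y₀ :=
    (hf.contDiffAt (hU.mem_nhds (hKU ⟨hx₀, hy₀⟩))).comp y₀
      (contDiffAt_const.prodMk contDiffAt_id)
  obtain ⟨ε, hε, hexp⟩ := (hslice.hasStrictDerivAt one_ne_zero).exists_expanding hdy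
  calc 0 < dimH (S'.K ∩ Metric.ball y₀ ε) := hreg'.dimH_K_inter_ball_pos hψ hy₀ hε
    _ ≤ dimH ((fun y => f (x₀, y)) '' (S'.K ∩ Metric.ball y₀ ε)) :=
      le_dimH_image_of_expanding (half_pos (abs_pos.2 hdy))
        fun y hy z hz => hexp y hy.2 z hz.2
    _ ≤ dimH (f '' (S.K ×ˢ S'.K)) := dimH_mono <| by
      rintro _ ⟨y, hy, rfl⟩
      exact ⟨(x₀, y), ⟨hx₀, hy.1⟩, rfl⟩
end
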